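/- arXiv:2309.02829 — 2 statements merged into one kernel-verified Lean document; each statement's English description precedes it below -/
import Mathlib

section
/- Let P be a Markov kernel on a measurable space E satisfying the mixing condition (A.1) with Λ ∈ (0,1), and let g : E → ℝ be bounded measurable with ‖g‖_sp < −(1/2)·log Λ. Then a bounded MPE solution exists: there are a bounded measurable w : E → ℝ and λ ∈ ℝ such that w(x) = g(x) − λ + μ_x(w) for all x ∈ E. -/
open MeasureTheory ProbabilityTheory

/-- The span seminorm `‖f‖_sp = (sup f - inf f)/2`. -/
noncomputable def spanSeminorm {E : Type*} (f : E → ℝ) : ℝ :=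
  ((⨆ x, f x) - ⨅ x, f x) / 2

lemma aux_integrable {E : Type*} [MeasurableSpace E] (μ : Measure E) [IsProbabilityMeasure μ]
    (f : E → ℝ) (hf : Measurable f) (m M : ℝ) (hm : ∀ x, m ≤ f x) (hM : ∀ x, f x ≤ M) :
    Integrable f μ :=
  Integrable.of_bound hf.aestronglyMeasurable (max |m| |M|)
    (Filter.Eventually.of_forall fun x => by
      rw [Real.norm_eq_abs]; exact abs_le_max_abs_abs (hm x) (hM x))

lemma aux_mix0 {E : Type*} [MeasurableSpace E] (μ ν : Measure E) [IsProbabilityMeasure μ]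
    [IsProbabilityMeasure ν] (K : ℝ)
    (h : ∀ B : Set E, MeasurableSet B → μ.real B - ν.real B ≤ K)
    (f : E → ℝ) (hf : Measurable f) (M : ℝ) (hM0 : 0 ≤ M) (hm : ∀ x, 0 ≤ f x) (hM : ∀ x, f x ≤ M) :
    ∫ x, f x ∂μ - ∫ x, f x ∂ν ≤ K * M := by
  have key : ∀ (ρ : Measure E) [IsProbabilityMeasure ρ],
      ∫ x, f x ∂ρ = ∫ t in (0:ℝ)..M, ρ.real {a | t ≤ f a} := by
    intro ρ _
    rw [intervalIntegral.integral_of_le hM0]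
    exact (aux_integrable ρ f hf 0 M hm hM).integral_eq_integral_Ioc_meas_le
      (Filter.Eventually.of_forall hm) (Filter.Eventually.of_forall hM)
  have hint : ∀ (ρ : Measure E) [IsProbabilityMeasure ρ],
      IntervalIntegrable (fun t => ρ.real {a | t ≤ f a}) volume 0 M := by
    intro ρ _
    apply AntitoneOn.intervalIntegrable
    intro s _ t _ hst
    exact measureReal_mono (fun a (ha : t ≤ f a) => le_trans hst ha)
  rw [key μ, key ν, ← intervalIntegral.integral_sub (hint μ) (hint ν)]
  calc _ ≤ ∫ t in (0:ℝ)..M, K := by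
        apply intervalIntegral.integral_mono_on hM0 ((hint μ).sub (hint ν)) (by simp)
        intro t _
        exact h _ (measurableSet_le measurable_const hf)
    _ = K * M := by simp [mul_comm]

lemma aux_mix {E : Type*} [MeasurableSpace E] (μ ν : Measure E) [IsProbabilityMeasure μ]
    [IsProbabilityMeasure ν] (K : ℝ)
    (h : ∀ B : Set E, MeasurableSet B → μ.real B - ν.real B ≤ K)
    (f : E → ℝ) (hf : Measurable f) (m M : ℝ) (hmM : m ≤ M)
    (hm : ∀ x, m ≤ f x) (hM : ∀ x, f x ≤ M) :
    ∫ x, f x ∂μ - ∫ x, f x ∂ν ≤ K * (M - m) := by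
  have := aux_mix0 μ ν K h (fun x => f x - m) (hf.sub_const m) (M - m) (by linarith)
    (fun x => by linarith [hm x]) (fun x => by linarith [hM x])
  rw [integral_sub (aux_integrable μ f hf m M hm hM) (integrable_const _),
    integral_sub (aux_integrable ν f hf m M hm hM) (integrable_const _)] at this
  simpa using this

/-- From pairwise ratio bounds to a common bound. -/
lemma aux_inf {E : Type*} [Nonempty E] (u : E → ℝ) (R : ℝ) (hR : 1 ≤ R) (hpos : ∀ x, 0 < u x)
    (h : ∀ x y, u x ≤ R * u y) : ∃ m, 0 < m ∧ (∀ x, m ≤ u x) ∧ ∀ x, u x ≤ R * m := by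
  have hR0 : 0 < R := by linarith
  obtain ⟨x0⟩ := ‹Nonempty E›
  have hb : BddBelow (Set.range u) := ⟨0, by rintro _ ⟨x, rfl⟩; exact (hpos x).le⟩
  have hle : ∀ x, u x / R ≤ ⨅ y, u y := fun x =>
    haveI : Nonempty E := ⟨x0⟩
    le_ciInf fun y => by rw [div_le_iff₀ hR0]; linarith [h x y]
  refine ⟨⨅ x, u x, ?_, fun x => ciInf_le hb x, fun x => ?_⟩
  · exact lt_of_lt_of_le (div_pos (hpos x0) hR0) (hle x0)
  · have := hle x
    rw [div_le_iff₀ hR0] at this; linarith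

/-- Contraction of ratios. -/
lemma aux_contract {E : Type*} [MeasurableSpace E] [Nonempty E] (μ ν : Measure E)
    [IsProbabilityMeasure μ] [IsProbabilityMeasure ν] (K : ℝ)
    (h : ∀ B : Set E, MeasurableSet B → ν.real B - μ.real B ≤ K)
    (u v : E → ℝ) (hu : Measurable u) (hv : Measurable v) (m R : ℝ) (hm : 0 < m) (hR : 1 ≤ R)
    (hvm : ∀ x, m ≤ v x) (hvR : ∀ x, v x ≤ R * m)
    (a b : ℝ) (ha : ∀ x, a ≤ u x / v x) (hb : ∀ x, u x / v x ≤ b) :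
    (∫ x, u x ∂ν) / (∫ x, v x ∂ν) - (∫ x, u x ∂μ) / (∫ x, v x ∂μ)
      ≤ (1 - (1 - K) / R) * (b - a) ∧
    a ≤ (∫ x, u x ∂μ) / (∫ x, v x ∂μ) ∧ (∫ x, u x ∂μ) / (∫ x, v x ∂μ) ≤ b := by
  have hR0 : 0 < R := by linarith
  obtain ⟨x0⟩ := ‹Nonempty E›
  have hab : a ≤ b := (ha x0).trans (hb x0)
  have hv0 : ∀ x, 0 < v x := fun x => hm.trans_le (hvm x)
  have hr : Measurable (fun x => u x / v x) := hu.div hv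
  have main : ∀ (ρ : Measure E) [IsProbabilityMeasure ρ],
      (∫ x, u x / v x ∂ρ - a) / R ≤ (∫ x, u x ∂ρ) / (∫ x, v x ∂ρ) - a ∧
      (b - ∫ x, u x / v x ∂ρ) / R ≤ b - (∫ x, u x ∂ρ) / (∫ x, v x ∂ρ) ∧
      a ≤ ∫ x, u x / v x ∂ρ ∧ ∫ x, u x / v x ∂ρ ≤ b := by
    intro ρ _
    have ir := aux_integrable ρ _ hr a b ha hb
    have iv := aux_integrable ρ v hv m (R * m) hvm hvR
    have iu : Integrable u ρ := by
      have : Integrable (fun x => (u x / v x) * v x) ρ := by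
        refine ir.mul_bdd (c := R * m) hv.aestronglyMeasurable (Filter.Eventually.of_forall fun x => ?_)
        rw [Real.norm_eq_abs, abs_of_pos (hv0 x)]; exact hvR x
      refine this.congr (Filter.Eventually.of_forall fun x => ?_)
      exact div_mul_cancel₀ _ (hv0 x).ne'
    have Nm : m ≤ ∫ x, v x ∂ρ := by
      have := integral_mono (μ := ρ) (integrable_const m) iv hvm
      simpa using this
    have NR : ∫ x, v x ∂ρ ≤ R * m := by
      have := integral_mono (μ := ρ) iv (integrable_const (R * m)) hvR
      simpa using this
    have ra : a ≤ ∫ x, u x / v x ∂ρ := by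
      have := integral_mono (μ := ρ) (integrable_const a) ir ha
      simpa using this
    have rb : ∫ x, u x / v x ∂ρ ≤ b := by
      have := integral_mono (μ := ρ) ir (integrable_const b) hb
      simpa using this
    have N0 : 0 < ∫ x, v x ∂ρ := hm.trans_le Nm
    have e1 : m * (∫ x, u x / v x ∂ρ - a) ≤ ∫ x, u x ∂ρ - a * ∫ x, v x ∂ρ := by
      have := integral_mono (μ := ρ) ((ir.sub (integrable_const a)).const_mul m)
        (iu.sub (iv.const_mul a)) (fun x => by
          have h1 : u x = (u x / v x) * v x := (div_mul_cancel₀ _ (hv0 x).ne').symm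
          have h2 := ha x
          have h3 := hvm x
          simp only [Pi.sub_apply]
          nlinarith [mul_nonneg (sub_nonneg.2 h2) (sub_nonneg.2 h3)])
      simp only [Pi.sub_apply] at this
      rw [integral_const_mul, integral_sub ir (integrable_const _),
        integral_sub iu (iv.const_mul a), integral_const_mul] at this
      simpa using this
    have e2 : m * (b - ∫ x, u x / v x ∂ρ) ≤ b * ∫ x, v x ∂ρ - ∫ x, u x ∂ρ := by
      have := integral_mono (μ := ρ) (((integrable_const b).sub ir).const_mul m)
        ((iv.const_mul b).sub iu) (fun x => by
          have h1 : u x = (u x / v x) * v x := (div_mul_cancel₀ _ (hv0 x).ne').symm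
          have h2 := hb x
          have h3 := hvm x
          simp only [Pi.sub_apply]
          nlinarith [mul_nonneg (sub_nonneg.2 h2) (sub_nonneg.2 h3)])
      simp only [Pi.sub_apply] at this
      rw [integral_const_mul, integral_sub (integrable_const _) ir,
        integral_sub (iv.const_mul b) iu, integral_const_mul] at this
      simpa using this
    refine ⟨?_, ?_, ra, rb⟩
    · rw [div_sub' N0.ne', div_le_div_iff₀ hR0 N0]
      have := mul_le_mul_of_nonneg_left NR (sub_nonneg.2 ra)
      have := mul_le_mul_of_nonneg_left e1 hR0.le
      nlinarith
    · rw [sub_div' N0.ne', div_le_div_iff₀ hR0 N0]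
      have := mul_le_mul_of_nonneg_left NR (sub_nonneg.2 rb)
      have := mul_le_mul_of_nonneg_left e2 hR0.le
      nlinarith
  obtain ⟨m1, m2, m3, m4⟩ := main μ
  obtain ⟨n1, n2, n3, n4⟩ := main ν
  have hx := aux_mix ν μ K h _ hr a b hab ha hb
  have p1 : 0 ≤ (∫ x, u x / v x ∂μ - a) / R := div_nonneg (sub_nonneg.2 m3) hR0.le
  have p2 : 0 ≤ (b - ∫ x, u x / v x ∂μ) / R := div_nonneg (sub_nonneg.2 m4) hR0.le
  refine ⟨?_, by linarith, by linarith⟩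
  have : (1 - K) / R * (b - a) ≤
      (∫ x, u x / v x ∂μ - a) / R + (b - ∫ x, u x / v x ∂ν) / R := by
    rw [← add_div, div_mul_eq_mul_div]
    apply div_le_div_of_nonneg_right _ hR0.le
    linarith
  linarith

/-- The multiplicative operator. -/
noncomputable def auxF {E : Type*} [MeasurableSpace E] (P : Kernel E E) (g : E → ℝ)
    (u : E → ℝ) : E → ℝ := fun x => Real.exp (g x) * ∫ y, u y ∂(P x)

lemma auxF_meas {E : Type*} [MeasurableSpace E] (P : Kernel E E) [IsMarkovKernel P] (g : E → ℝ)
    (hg : Measurable g) (u : E → ℝ) (hu : Measurable u) : Measurable (auxF P g u) :=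
  (Real.measurable_exp.comp hg).mul
    (hu.stronglyMeasurable.integral_kernel (κ := P)).measurable

lemma auxF_step {E : Type*} [MeasurableSpace E] [Nonempty E] (P : Kernel E E) [IsMarkovKernel P]
    (Λ : ℝ) (hmix : ∀ x x' : E, ∀ B : Set E, MeasurableSet B →
      (P x).real B - (P x').real B ≤ Λ) (hΛ : 0 < Λ)
    (g : E → ℝ) (D R : ℝ) (hD : ∀ x y, Real.exp (g x) ≤ D * Real.exp (g y))
    (hR : 1 ≤ R) (hDR : D * (1 + Λ * (R - 1)) = R)
    (u : E → ℝ) (hu : Measurable u) (hpos : ∀ x, 0 < u x) (hur : ∀ x y, u x ≤ R * u y) :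
    (∀ x, 0 < auxF P g u x) ∧ ∀ x y, auxF P g u x ≤ R * auxF P g u y := by
  obtain ⟨m, hm, h1, h2⟩ := aux_inf u R hR hpos hur
  have hI : ∀ x, m ≤ ∫ y, u y ∂(P x) := fun x => by
    have := integral_mono (μ := P x) (integrable_const m) (aux_integrable _ u hu m _ h1 h2) h1
    simpa using this
  refine ⟨fun x => mul_pos (Real.exp_pos _) (hm.trans_le (hI x)), fun x y => ?_⟩
  have hx := aux_mix (P x) (P y) Λ (hmix x y) u hu m (R * m) (by nlinarith) h1 h2
  have hy := hI y
  have h3 : ∫ z, u z ∂(P x) ≤ (1 + Λ * (R - 1)) * ∫ z, u z ∂(P y) := by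
    have : 0 ≤ Λ * (R - 1) := mul_nonneg hΛ.le (by linarith)
    nlinarith
  unfold auxF
  calc _ ≤ (D * Real.exp (g y)) * ((1 + Λ * (R - 1)) * ∫ z, u z ∂(P y)) :=
        mul_le_mul (hD x y) h3 (hm.le.trans (hI x)) ((Real.exp_pos _).le.trans (hD x y))
    _ = (D * (1 + Λ * (R - 1))) * (Real.exp (g y) * ∫ z, u z ∂(P y)) := by ring
    _ = _ := by rw [hDR]

lemma aux_main {E : Type*} [MeasurableSpace E] [Nonempty E] (P : Kernel E E) [IsMarkovKernel P]
    (Λ : ℝ) (hmix : ∀ x x' : E, ∀ B : Set E, MeasurableSet B →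
      (P x).real B - (P x').real B ≤ Λ) (hΛ : 0 < Λ) (hΛ1 : Λ < 1)
    (g : E → ℝ) (hg : Measurable g)
    (D R : ℝ) (hD : ∀ x y, Real.exp (g x) ≤ D * Real.exp (g y))
    (hR : 1 ≤ R) (hDR : D * (1 + Λ * (R - 1)) = R) :
    ∃ (w : E → ℝ) (lam : ℝ), Measurable w ∧ (∃ C : ℝ, ∀ x, |w x| ≤ C) ∧
      ∀ x : E, w x = g x - lam + Real.log (∫ y, Real.exp (w y) ∂(P x)) := by
  have hR0 : 0 < R := by linarith
  set u : ℕ → E → ℝ := fun n => (auxF P g)^[n] (fun _ => 1) with hu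
  have us : ∀ n, u (n + 1) = auxF P g (u n) := fun n => by
    simp only [hu, Function.iterate_succ_apply']
  have u0 : u 0 = fun _ => 1 := rfl
  have um : ∀ n, Measurable (u n) := by
    intro n
    induction n with
    | zero => rw [u0]; exact measurable_const
    | succ n ih => rw [us]; exact auxF_meas P g hg _ ih
  have ub : ∀ n, (∀ x, 0 < u n x) ∧ ∀ x y, u n x ≤ R * u n y := by
    intro n
    induction n with
    | zero => rw [u0]; exact ⟨fun _ => one_pos, fun _ _ => by simpa using hR⟩
    | succ n ih => rw [us]; exact auxF_step P Λ hmix hΛ g D R hD hR hDR _ (um n) ih.1 ih.2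
  set r : ℕ → E → ℝ := fun n x => u (n + 1) x / u n x with hr
  set κ : ℝ := 1 - (1 - Λ) / R with hκ
  have hκ1 : κ < 1 := by
    have : 0 < (1 - Λ) / R := div_pos (by linarith) hR0
    linarith
  have hκ0 : 0 ≤ κ := by
    have : (1 - Λ) / R ≤ 1 := by rw [div_le_one hR0]; linarith
    linarith
  have step : ∀ n a b, (∀ x, a ≤ r n x) → (∀ x, r n x ≤ b) →
      (∀ x y, r (n + 1) x - r (n + 1) y ≤ κ * (b - a)) ∧
      (∀ x, a ≤ r (n + 1) x) ∧ ∀ x, r (n + 1) x ≤ b := by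
    intro n a b ha hb
    obtain ⟨m, hm, h1, h2⟩ := aux_inf (u n) R hR (ub n).1 (ub n).2
    have e : ∀ x, r (n + 1) x = (∫ y, u (n + 1) y ∂(P x)) / (∫ y, u n y ∂(P x)) := by
      intro x
      simp only [hr]
      rw [us (n + 1), us n]
      simp only [auxF]
      exact mul_div_mul_left _ _ (Real.exp_pos _).ne'
    have c := fun x y => aux_contract (P y) (P x) Λ (hmix x y) (u (n + 1)) (u n) (um _) (um _) m R
      hm hR h1 h2 a b ha hb
    refine ⟨fun x y => ?_, fun x => ?_, fun x => ?_⟩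
    · rw [e, e]; exact (c x y).1
    · rw [e]; exact (c x x).2.1
    · rw [e]; exact (c x x).2.2
  -- nested intervals
  obtain ⟨x0⟩ := ‹Nonempty E›
  have : Nonempty E := ⟨x0⟩
  have r0p : ∀ x, 0 < r 0 x := fun x => div_pos ((ub 1).1 x) ((ub 0).1 x)
  have r0b : ∀ x y, r 0 x ≤ R * r 0 y := fun x y => by
    have := (ub 1).2 x y
    simpa [hr, u0] using this
  obtain ⟨A, hA, hA1, hA2⟩ := aux_inf (r 0) R hR r0p r0b
  have bd : ∀ n, (∀ x, A ≤ r n x) ∧ ∀ x, r n x ≤ R * A := by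
    intro n
    induction n with
    | zero => exact ⟨hA1, hA2⟩
    | succ n ih => exact (step n _ _ ih.1 ih.2).2
  have bbel : ∀ n, BddBelow (Set.range (r n)) := fun n =>
    ⟨A, by rintro _ ⟨x, rfl⟩; exact (bd n).1 x⟩
  have babv : ∀ n, BddAbove (Set.range (r n)) := fun n =>
    ⟨R * A, by rintro _ ⟨x, rfl⟩; exact (bd n).2 x⟩
  set a : ℕ → ℝ := fun n => ⨅ x, r n x with ha
  set b : ℕ → ℝ := fun n => ⨆ x, r n x with hb
  have ar : ∀ n x, a n ≤ r n x := fun n x => ciInf_le (bbel n) x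
  have rb : ∀ n x, r n x ≤ b n := fun n x => le_ciSup (babv n) x
  have amono : Monotone a := monotone_nat_of_le_succ fun n =>
    le_ciInf fun x => (step n _ _ (ar n) (rb n)).2.1 x
  have banti : Antitone b := antitone_nat_of_succ_le fun n =>
    ciSup_le fun x => (step n _ _ (ar n) (rb n)).2.2 x
  have gap : ∀ n, b (n + 1) - a (n + 1) ≤ κ * (b n - a n) := by
    intro n
    have h1 : ∀ x, b (n + 1) ≤ κ * (b n - a n) + r (n + 1) x := fun x =>
      ciSup_le fun y => by linarith [(step n _ _ (ar n) (rb n)).1 y x]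
    have : b (n + 1) - κ * (b n - a n) ≤ a (n + 1) :=
      le_ciInf fun x => by linarith [h1 x]
    linarith
  have gapn : ∀ n, b n - a n ≤ (b 0 - a 0) * κ ^ n := by
    intro n
    induction n with
    | zero => simp
    | succ n ih =>
      calc _ ≤ κ * (b n - a n) := gap n
        _ ≤ κ * ((b 0 - a 0) * κ ^ n) := mul_le_mul_of_nonneg_left ih hκ0
        _ = _ := by ring
  have ab : ∀ n k, a n ≤ b k := fun n k =>
    (amono (le_max_left n k)).trans
      (((ar _ x0).trans (rb _ x0)).trans (banti (le_max_right n k)))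
  set θ : ℝ := ⨆ n, a n with hθ
  have aθ : ∀ n, a n ≤ θ := fun n => le_ciSup ⟨b 0, by rintro _ ⟨k, rfl⟩; exact ab k 0⟩ n
  have θb : ∀ n, θ ≤ b n := fun n => ciSup_le fun k => ab k n
  have hAa : A ≤ a 0 := le_ciInf hA1
  have hθA : A ≤ θ := hAa.trans (aθ 0)
  have hθ0 : 0 < θ := hA.trans_le hθA
  have logle : ∀ s t : ℝ, A ≤ s → A ≤ t → Real.log s - Real.log t ≤ |s - t| / A := by
    intro s t hs ht
    have hs0 : 0 < s := hA.trans_le hs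
    have ht0 : 0 < t := hA.trans_le ht
    rw [← Real.log_div hs0.ne' ht0.ne']
    calc _ ≤ s / t - 1 := Real.log_le_sub_one_of_pos (div_pos hs0 ht0)
      _ = (s - t) / t := by field_simp
      _ ≤ |s - t| / t := div_le_div_of_nonneg_right (le_abs_self _) ht0.le
      _ ≤ |s - t| / A := div_le_div_of_nonneg_left (abs_nonneg _) hA ht
  set C : ℝ := (b 0 - a 0) / A with hC
  have logr : ∀ n x, |Real.log (r n x) - Real.log θ| ≤ C * κ ^ n := by
    intro n x
    have h1 : |r n x - θ| ≤ (b 0 - a 0) * κ ^ n := by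
      rw [abs_le]
      constructor <;> linarith [ar n x, rb n x, aθ n, θb n, gapn n]
    have h2 : |r n x - θ| / A ≤ C * κ ^ n := by
      calc _ ≤ ((b 0 - a 0) * κ ^ n) / A := div_le_div_of_nonneg_right h1 hA.le
        _ = _ := by rw [hC]; ring
    have h3 := logle _ _ ((bd n).1 x) hθA
    have h4 := logle _ _ hθA ((bd n).1 x)
    rw [abs_sub_comm] at h4
    rw [abs_le]; constructor <;> linarith
  set w : ℕ → E → ℝ := fun n x => Real.log (u n x) - n * Real.log θ with hw
  have wstep : ∀ x n, dist (w n x) (w (n + 1) x) ≤ C * κ ^ n := by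
    intro x n
    have := logr n x
    simp only [hr] at this
    rw [Real.log_div ((ub _).1 x).ne' ((ub _).1 x).ne'] at this
    rw [dist_comm, Real.dist_eq]
    simp only [hw]
    push_cast
    convert this using 2
    ring
  have hlim : ∀ x, ∃ l, Filter.Tendsto (fun n => w n x) Filter.atTop (nhds l) := fun x =>
    cauchySeq_tendsto_of_complete (cauchySeq_of_le_geometric κ C hκ1 (wstep x))
  choose W hW using hlim
  have w0 : ∀ x, w 0 x = 0 := fun x => by simp [hw, u0]
  have wd : ∀ n x, |w n x - W x| ≤ C / (1 - κ) := by
    intro n x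
    have h1 := dist_le_of_le_geometric_of_tendsto κ C hκ1 (wstep x) (hW x) n
    rw [Real.dist_eq] at h1
    refine h1.trans (div_le_div_of_nonneg_right ?_ (by linarith))
    have hC0 : 0 ≤ C := div_nonneg (by linarith [ab 0 0]) hA.le
    exact mul_le_of_le_one_right hC0 (pow_le_one₀ hκ0 hκ1.le)
  have Wb : ∀ x, |W x| ≤ C / (1 - κ) := fun x => by
    have := wd 0 x
    rwa [w0, zero_sub, abs_neg] at this
  have wb : ∀ n x, w n x ≤ 2 * (C / (1 - κ)) := fun n x => by
    have h1 := abs_le.1 (wd n x)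
    have h2 := abs_le.1 (Wb x)
    linarith
  have wm : ∀ n, Measurable (w n) := fun n =>
    (Real.measurable_log.comp (um n)).sub_const _
  have Wm : Measurable W := measurable_of_tendsto_metrizable wm (tendsto_pi_nhds.2 hW)
  refine ⟨W, Real.log θ, Wm, ⟨_, Wb⟩, fun x => ?_⟩
  have expw : ∀ n y, Real.exp (w n y) = u n y * (θ ^ n)⁻¹ := by
    intro n y
    simp only [hw]
    rw [Real.exp_sub, Real.exp_log ((ub n).1 y), ← Real.log_pow, Real.exp_log (pow_pos hθ0 n)]
    rfl
  have hrec : ∀ n, w (n + 1) x = g x - Real.log θ + Real.log (∫ y, Real.exp (w n y) ∂(P x)) := by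
    intro n
    have hpos := (ub (n + 1)).1 x
    have e1 : u (n + 1) x = Real.exp (g x) * ∫ y, u n y ∂(P x) := by rw [us]; rfl
    have hI : 0 < ∫ y, u n y ∂(P x) := by
      rw [e1] at hpos
      exact (pos_iff_pos_of_mul_pos hpos).1 (Real.exp_pos _)
    simp only [expw]
    rw [integral_mul_const, Real.log_mul hI.ne' (inv_ne_zero (pow_pos hθ0 n).ne'), Real.log_inv,
      Real.log_pow]
    simp only [hw]
    rw [e1, Real.log_mul (Real.exp_pos _).ne' hI.ne', Real.log_exp]
    push_cast
    ring
  have iW : Integrable (fun y => Real.exp (W y)) (P x) :=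
    aux_integrable _ _ (Real.measurable_exp.comp Wm) 0 (Real.exp (C / (1 - κ)))
      (fun y => (Real.exp_pos _).le) (fun y => Real.exp_le_exp.2 (le_of_abs_le (Wb y)))
  have hIW : 0 < ∫ y, Real.exp (W y) ∂(P x) := integral_exp_pos iW
  have hconv : Filter.Tendsto (fun n => ∫ y, Real.exp (w n y) ∂(P x)) Filter.atTop
      (nhds (∫ y, Real.exp (W y) ∂(P x))) := by
    refine tendsto_integral_of_dominated_convergence (fun _ => Real.exp (2 * (C / (1 - κ))))
      (fun n => (Real.measurable_exp.comp (wm n)).aestronglyMeasurable) (integrable_const _)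
      (fun n => Filter.Eventually.of_forall fun y => ?_)
      (Filter.Eventually.of_forall fun y => ?_)
    · rw [Real.norm_eq_abs, abs_of_pos (Real.exp_pos _)]
      exact Real.exp_le_exp.2 (wb n y)
    · exact (Real.continuous_exp.tendsto _).comp (hW y)
  have l1 := (hW x).comp (Filter.tendsto_add_atTop_nat 1)
  have l2 := (hconv.log hIW.ne').const_add (g x - Real.log θ)
  refine tendsto_nhds_unique l1 (l2.congr fun n => ?_)
  exact (hrec n).symm

/-- Under the mixing condition (A.1) with constant `Λ ∈ (0,1)`, if the bounded measurable
reward `g` satisfies `‖g‖_sp < -(1/2) log Λ`, then a bounded MPE solution exists. -/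
theorem mpe_exists_of_small_span {E : Type*} [MeasurableSpace E]
    (P : Kernel E E) [IsMarkovKernel P]
    (Λ : ℝ) (hΛ : Λ ∈ Set.Ioo (0 : ℝ) 1)
    (hmix : ∀ B : Set E, MeasurableSet B → ∀ x x' : E,
      |(P x B).toReal - (P x' B).toReal| ≤ Λ)
    (g : E → ℝ) (hg_meas : Measurable g) (Cg : ℝ) (hg_bdd : ∀ x, |g x| ≤ Cg)
    (hg_span : spanSeminorm g < -(1 / 2) * Real.log Λ) :
    ∃ (w : E → ℝ) (lam : ℝ), Measurable w ∧ (∃ C : ℝ, ∀ x, |w x| ≤ C) ∧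
      ∀ x : E, w x = g x - lam + Real.log (∫ y, Real.exp (w y) ∂(P x)) := by
  obtain ⟨hΛ0, hΛ1⟩ := hΛ
  rcases isEmpty_or_nonempty E with hE | hE
  · exact ⟨fun _ => 0, 0, measurable_const, ⟨0, fun x => (hE.false x).elim⟩,
      fun x => (hE.false x).elim⟩
  have hba : BddAbove (Set.range g) :=
    ⟨Cg, by rintro _ ⟨x, rfl⟩; exact (abs_le.1 (hg_bdd x)).2⟩
  have hbb : BddBelow (Set.range g) :=
    ⟨-Cg, by rintro _ ⟨x, rfl⟩; exact (abs_le.1 (hg_bdd x)).1⟩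
  set d : ℝ := (⨆ x, g x) - ⨅ x, g x with hd
  have hgd : ∀ x y, g x ≤ d + g y := fun x y => by
    have := le_ciSup hba x
    have := ciInf_le hbb y
    linarith
  have hd0 : 0 ≤ d := by
    obtain ⟨x⟩ := hE
    linarith [hgd x x]
  have hdl : d < - Real.log Λ := by
    unfold spanSeminorm at hg_span
    linarith
  have hD1 : 1 ≤ Real.exp d := Real.one_le_exp hd0
  have hDΛ : Real.exp d * Λ < 1 := by
    have h1 : Real.exp d < Real.exp (- Real.log Λ) := Real.exp_lt_exp.2 hdl
    rw [Real.exp_neg, Real.exp_log hΛ0] at h1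
    calc _ < Λ⁻¹ * Λ := mul_lt_mul_of_pos_right h1 hΛ0
      _ = 1 := inv_mul_cancel₀ hΛ0.ne'
  have hq : 0 < 1 - Real.exp d * Λ := by linarith
  refine aux_main P Λ (fun x x' B hB => (le_abs_self _).trans (hmix B hB x x')) hΛ0 hΛ1 g hg_meas
    (Real.exp d) (Real.exp d * (1 - Λ) / (1 - Real.exp d * Λ)) (fun x y => ?_) ?_ ?_
  · rw [← Real.exp_add]; exact Real.exp_le_exp.2 (hgd x y)
  · rw [le_div_iff₀ hq]; linarith
  · field_simp
    ring
end

section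
/- Let P be a Markov kernel on a measurable space E satisfying the multi-step strong mixing condition (A.3): there exist n ≥ 1 and L ≥ 1 such that P_n(x,B) ≤ L·P_n(x',B) for all x, x' ∈ E and all measurable B. Then for every bounded measurable g : E → ℝ a bounded MPE solution exists: there are a bounded measurable w : E → ℝ and λ ∈ ℝ with w(x) = g(x) − λ + μ_x(w) for all x ∈ E. -/
open MeasureTheory ProbabilityTheory

/-- The `n`-step kernel `P_n`: the `n`-fold composition of `P` with itself
(`stepKernel P 0` is the identity kernel and `stepKernel P 1 = P`). -/
noncomputable def stepKernel {E : Type*} [MeasurableSpace E] (P : Kernel E E) : ℕ → Kernel E E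
  | 0 => Kernel.id
  | n + 1 => (stepKernel P n) ∘ₖ P


namespace MPEAux

open Filter Topology

variable {E : Type*} [MeasurableSpace E]

/-- Bounded measurable functions. -/
def Good (f : E → ℝ) : Prop := Measurable f ∧ ∃ C : ℝ, ∀ x, |f x| ≤ C

lemma Good.integrable {f : E → ℝ} (hf : Good f) (μ : Measure E) [IsFiniteMeasure μ] :
    Integrable f μ := by
  obtain ⟨hm, C, hC⟩ := hf
  exact Integrable.of_bound hm.aestronglyMeasurable C (Eventually.of_forall hC)

lemma Good.comb {f h : E → ℝ} (hf : Good f) (hh : Good h) (a b : ℝ) :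
    Good (fun x => a * f x + b * h x) := by
  obtain ⟨hm, C, hC⟩ := hf
  obtain ⟨hm', C', hC'⟩ := hh
  refine ⟨(hm.const_mul a).add (hm'.const_mul b), |a| * C + |b| * C', fun x => ?_⟩
  refine (abs_add_le _ _).trans ?_
  rw [abs_mul, abs_mul]
  exact add_le_add (mul_le_mul_of_nonneg_left (hC x) (abs_nonneg _))
    (mul_le_mul_of_nonneg_left (hC' x) (abs_nonneg _))

lemma Good.integral {f : E → ℝ} (hf : Good f) (κ : Kernel E E) [IsMarkovKernel κ] :
    Good (fun x => ∫ y, f y ∂(κ x)) := by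
  obtain ⟨hm, C, hC⟩ := hf
  refine ⟨(hm.stronglyMeasurable.integral_kernel).measurable, C, fun x => ?_⟩
  have := norm_integral_le_of_norm_le_const (μ := κ x) (f := f) (C := C) (Eventually.of_forall hC)
  simpa using this

/-- The multiplicative transfer operator. -/
noncomputable def T (P : Kernel E E) (g : E → ℝ) (f : E → ℝ) : E → ℝ :=
  fun x => Real.exp (g x) * ∫ y, f y ∂(P x)

variable {P : Kernel E E} [IsMarkovKernel P] {g : E → ℝ} {Cg : ℝ}

lemma Good.T (hg : Measurable g) (hb : ∀ x, |g x| ≤ Cg) {f : E → ℝ} (hf : Good f) :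
    Good (T P g f) := by
  obtain ⟨hm, C, hC⟩ := hf.integral P
  refine ⟨(Real.measurable_exp.comp hg).mul hm, Real.exp Cg * C, fun x => ?_⟩
  unfold MPEAux.T
  rw [abs_mul, abs_of_pos (Real.exp_pos _)]
  exact mul_le_mul (Real.exp_le_exp.2 (le_of_abs_le (hb x))) (hC x) (abs_nonneg _)
    (Real.exp_pos _).le

lemma Good.iter (hg : Measurable g) (hb : ∀ x, |g x| ≤ Cg) {f : E → ℝ} (hf : Good f) (k : ℕ) :
    Good ((MPEAux.T P g)^[k] f) := by
  induction k with
  | zero => exact hf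
  | succ k ih => rw [Function.iterate_succ_apply']; exact ih.T hg hb

lemma T_comb {f h : E → ℝ} (hf : Good f) (hh : Good h) (a b : ℝ) :
    T P g (fun x => a * f x + b * h x) = fun x => a * T P g f x + b * T P g h x := by
  funext x
  unfold T
  rw [integral_add ((hf.integrable _).const_mul a) ((hh.integrable _).const_mul b),
    integral_const_mul, integral_const_mul]
  ring

lemma iter_comb (hg : Measurable g) (hb : ∀ x, |g x| ≤ Cg) {f h : E → ℝ} (hf : Good f)
    (hh : Good h) (a b : ℝ) (k : ℕ) :
    (T P g)^[k] (fun x => a * f x + b * h x)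
      = fun x => a * (T P g)^[k] f x + b * (T P g)^[k] h x := by
  induction k with
  | zero => rfl
  | succ k ih =>
    rw [Function.iterate_succ_apply', ih, T_comb (hf.iter hg hb k) (hh.iter hg hb k)]
    simp only [Function.iterate_succ_apply']

lemma iter_nonneg {f : E → ℝ} (hf : ∀ x, 0 ≤ f x) (k : ℕ) : ∀ x, 0 ≤ (T P g)^[k] f x := by
  induction k with
  | zero => exact hf
  | succ k ih =>
    intro x
    rw [Function.iterate_succ_apply']
    exact mul_nonneg (Real.exp_pos _).le (integral_nonneg ih)

instance (k : ℕ) : IsMarkovKernel (stepKernel P k) := by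
  induction k with
  | zero => unfold stepKernel; infer_instance
  | succ k ih => unfold stepKernel; infer_instance

lemma iter_bounds (hg : Measurable g) (hb : ∀ x, |g x| ≤ Cg) {f : E → ℝ} (hf : Good f)
    (h0 : ∀ x, 0 ≤ f x) (k : ℕ) : ∀ x,
    Real.exp (-(k * Cg)) * (∫ y, f y ∂(stepKernel P k x)) ≤ (T P g)^[k] f x ∧
    (T P g)^[k] f x ≤ Real.exp (k * Cg) * (∫ y, f y ∂(stepKernel P k x)) := by
  induction k with
  | zero =>
    intro x
    simp [stepKernel, Kernel.id_apply, integral_dirac' _ _ hf.1.stronglyMeasurable]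
  | succ k ih =>
    intro x
    have hstep : ∫ y, f y ∂(stepKernel P (k+1) x)
        = ∫ z, ∫ y, f y ∂(stepKernel P k z) ∂(P x) := by
      have := hf.integrable ((stepKernel P k ∘ₖ P) x)
      exact Kernel.integral_comp this
    have hJ := hf.integral (stepKernel P k)
    have hTi := (hf.iter (P := P) hg hb k)
    have hnn : 0 ≤ ∫ y, (T P g)^[k] f y ∂(P x) := integral_nonneg (iter_nonneg h0 k)
    have h1 : Real.exp (-(k * Cg)) * ∫ z, ∫ y, f y ∂(stepKernel P k z) ∂(P x)
        ≤ ∫ y, (T P g)^[k] f y ∂(P x) := by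
      rw [← integral_const_mul]
      exact integral_mono ((hJ.integrable _).const_mul _) (hTi.integrable _) fun z => (ih z).1
    have h2 : ∫ y, (T P g)^[k] f y ∂(P x)
        ≤ Real.exp (k * Cg) * ∫ z, ∫ y, f y ∂(stepKernel P k z) ∂(P x) := by
      rw [← integral_const_mul]
      exact integral_mono (hTi.integrable _) ((hJ.integrable _).const_mul _) fun z => (ih z).2
    rw [Function.iterate_succ_apply', hstep]
    have e1 : Real.exp (-(((k+1 : ℕ):ℝ) * Cg)) = Real.exp (-Cg) * Real.exp (-(k * Cg)) := by
      rw [← Real.exp_add]; congr 1; push_cast; ring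
    have e2 : Real.exp (((k+1 : ℕ):ℝ) * Cg) = Real.exp (Cg) * Real.exp (k * Cg) := by
      rw [← Real.exp_add]; congr 1; push_cast; ring
    rw [e1, e2, mul_assoc, mul_assoc]
    have hbx := abs_le.1 (hb x)
    constructor
    · exact (mul_le_mul_of_nonneg_left h1 (Real.exp_pos _).le).trans
        (mul_le_mul_of_nonneg_right (Real.exp_le_exp.2 hbx.1) hnn)
    · exact (mul_le_mul_of_nonneg_right (Real.exp_le_exp.2 hbx.2) hnn).trans
        (mul_le_mul_of_nonneg_left h2 (Real.exp_pos _).le)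

lemma step_le {n : ℕ} {L : ℝ} (hL : 1 ≤ L)
    (hsm : ∀ x x' : E, ∀ B : Set E, MeasurableSet B →
      ((stepKernel P n) x B).toReal ≤ L * ((stepKernel P n) x' B).toReal)
    {f : E → ℝ} (hf : Good f) (h0 : ∀ x, 0 ≤ f x) (x x' : E) :
    ∫ y, f y ∂(stepKernel P n x) ≤ L * ∫ y, f y ∂(stepKernel P n x') := by
  have hle : stepKernel P n x ≤ L.toNNReal • stepKernel P n x' := by
    refine Measure.le_iff.2 fun B hB => ?_
    have := hsm x x' B hB
    rw [← ENNReal.toReal_le_toReal (measure_ne_top _ _) (measure_ne_top _ _)]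
    refine this.trans (le_of_eq ?_)
    rw [Measure.smul_apply, ENNReal.smul_def, smul_eq_mul, ENNReal.toReal_mul,
      ENNReal.coe_toReal, Real.coe_toNNReal _ (zero_le_one.trans hL)]
  have := integral_mono_measure hle (Eventually.of_forall h0) (hf.integrable _)
  rw [integral_smul_nnreal_measure] at this
  refine this.trans (le_of_eq ?_)
  rw [NNReal.smul_def, smul_eq_mul, Real.coe_toNNReal _ (zero_le_one.trans hL)]

lemma iter_harnack {n : ℕ} {L : ℝ} (hL : 1 ≤ L)
    (hsm : ∀ x x' : E, ∀ B : Set E, MeasurableSet B →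
      ((stepKernel P n) x B).toReal ≤ L * ((stepKernel P n) x' B).toReal)
    (hg : Measurable g) (hb : ∀ x, |g x| ≤ Cg)
    {f : E → ℝ} (hf : Good f) (h0 : ∀ x, 0 ≤ f x) (x x' : E) :
    (T P g)^[n] f x ≤ (L * Real.exp (2 * (n * Cg))) * (T P g)^[n] f x' := by
  have h1 := (iter_bounds (P := P) hg hb hf h0 n x).2
  have h2 := (iter_bounds (P := P) hg hb hf h0 n x').1
  have h3 := step_le hL hsm hf h0 x x'
  have h4 : ∫ y, f y ∂(stepKernel P n x') ≤ Real.exp (n * Cg) * (T P g)^[n] f x' := by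
    have := mul_le_mul_of_nonneg_left h2 (Real.exp_pos (n * Cg)).le
    rwa [← mul_assoc, ← Real.exp_add, add_neg_cancel, Real.exp_zero, one_mul] at this
  have e : Real.exp (2 * (n * Cg)) = Real.exp (n * Cg) * Real.exp (n * Cg) := by
    rw [← Real.exp_add]; congr 1; ring
  have hp := Real.exp_pos (n * Cg)
  calc _ ≤ _ := h1
    _ ≤ Real.exp (n * Cg) * (L * ∫ y, f y ∂(stepKernel P n x')) := by gcongr
    _ ≤ Real.exp (n * Cg) * (L * (Real.exp (n * Cg) * (T P g)^[n] f x')) := by gcongr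
    _ = _ := by rw [e]; ring

/-- Pure contraction step. `K` is the Harnack constant. -/
lemma contract {n : ℕ} {K : ℝ} (hK : 1 ≤ K) (hg : Measurable g) (hb : ∀ x, |g x| ≤ Cg)
    (har : ∀ f : E → ℝ, Good f → (∀ x, 0 ≤ f x) → ∀ x x',
      (T P g)^[n] f x ≤ K * (T P g)^[n] f x')
    {f h : E → ℝ} (hf : Good f) (hh : Good h) (hh0 : ∀ x, 0 ≤ h x)
    (hpos : ∀ x, 0 < (T P g)^[n] h x) (x0 : E)
    {m M : ℝ} (h1 : ∀ x, m * h x ≤ f x) (h2 : ∀ x, f x ≤ M * h x) :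
    ∃ m' M', m ≤ m' ∧ M' - m' = (1 - (K⁻¹) ^ 2) * (M - m) ∧
      (∀ x, m' * (T P g)^[n] h x ≤ (T P g)^[n] f x) ∧
      (∀ x, (T P g)^[n] f x ≤ M' * (T P g)^[n] h x) := by
  have hK0 : 0 < K := by linarith
  set F := (T P g)^[n] f with hF
  set H := (T P g)^[n] h with hH
  set b := F x0 / H x0 with hbdef
  have hbH : F x0 = b * H x0 := by rw [hbdef, div_mul_cancel₀ _ (hpos x0).ne']
  have key : ∀ a c : ℝ, (∀ x, 0 ≤ a * f x + c * h x) →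
      0 ≤ a * b + c ∧ ∀ x, (K⁻¹)^2 * (a * b + c) * H x ≤ a * F x + c * H x := by
    intro a c hac
    have hc := iter_comb (P := P) hg hb hf hh a c n
    have hnn := iter_nonneg (P := P) (g := g) hac n x0
    rw [hc] at hnn
    have hnn' : 0 ≤ a * b + c := by
      have : 0 ≤ (a * b + c) * H x0 := by
        have : a * F x0 + c * H x0 = (a * b + c) * H x0 := by rw [hbH]; ring
        rw [← this]; exact hnn
      exact nonneg_of_mul_nonneg_left this (hpos x0)
    refine ⟨hnn', fun x => ?_⟩
    have i1 := har _ (hf.comb hh a c) hac x0 x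
    rw [hc] at i1
    have i2 := har h hh hh0 x x0
    change a * F x0 + c * H x0 ≤ K * (a * F x + c * H x) at i1
    change H x ≤ K * H x0 at i2
    have i3 : (a * b + c) * H x ≤ K * (K * (a * F x + c * H x)) := by
      calc _ ≤ (a * b + c) * (K * H x0) := mul_le_mul_of_nonneg_left i2 hnn'
        _ = K * (a * F x0 + c * H x0) := by rw [hbH]; ring
        _ ≤ _ := mul_le_mul_of_nonneg_left i1 hK0.le
    have : (K⁻¹)^2 * ((a * b + c) * H x) ≤ (K⁻¹)^2 * (K * (K * (a * F x + c * H x))) :=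
      mul_le_mul_of_nonneg_left i3 (by positivity)
    have e : (K⁻¹)^2 * (K * (K * (a * F x + c * H x))) = a * F x + c * H x := by
      field_simp
    rw [e] at this
    linarith
  obtain ⟨p1, p2⟩ := key 1 (-m) (fun x => by linarith [h1 x])
  obtain ⟨q1, q2⟩ := key (-1) M (fun x => by linarith [h2 x])
  refine ⟨m + (K⁻¹)^2 * (b - m), M - (K⁻¹)^2 * (M - b), ?_, by ring, fun x => ?_, fun x => ?_⟩
  · have : 0 ≤ (K⁻¹)^2 * (b - m) := mul_nonneg (by positivity) (by linarith)
    linarith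
  · have := p2 x
    linarith
  · have := q2 x
    linarith

/-- Iterates of the constant function one. -/
noncomputable def F (P : Kernel E E) (g : E → ℝ) (k : ℕ) : E → ℝ := (T P g)^[k] (fun _ => 1)

lemma good_one : Good (fun _ : E => (1 : ℝ)) := ⟨measurable_const, 1, fun _ => by simp⟩

lemma good_F (hg : Measurable g) (hb : ∀ x, |g x| ≤ Cg) (k : ℕ) : Good (F P g k) :=
  good_one.iter hg hb k

lemma F_succ (k : ℕ) (x : E) :
    F P g (k + 1) x = Real.exp (g x) * ∫ y, F P g k y ∂(P x) := by
  unfold F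
  rw [Function.iterate_succ_apply']
  rfl

lemma F_pos (hg : Measurable g) (hb : ∀ x, |g x| ≤ Cg) (k : ℕ) (x : E) : 0 < F P g k x := by
  have := (iter_bounds (P := P) hg hb (good_one (E := E)) (fun _ => zero_le_one) k x).1
  refine lt_of_lt_of_le ?_ this
  simp [Real.exp_pos]

lemma F_add (k l : ℕ) : F P g (k + l) = (T P g)^[k] (F P g l) := by
  unfold F
  rw [Function.iterate_add_apply]

/-- Ratio bounds persist. -/
lemma persist (hg : Measurable g) (hb : ∀ x, |g x| ≤ Cg) {m M : ℝ} {k : ℕ}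
    (h1 : ∀ x, m * F P g k x ≤ F P g (k + 1) x) (h2 : ∀ x, F P g (k + 1) x ≤ M * F P g k x)
    (l : ℕ) : (∀ x, m * F P g (l + k) x ≤ F P g (l + k + 1) x) ∧
      (∀ x, F P g (l + k + 1) x ≤ M * F P g (l + k) x) := by
  have c1 := iter_comb (P := P) hg hb (good_F (P := P) hg hb (k+1)) (good_F (P := P) hg hb k)
    1 (-m) l
  have c2 := iter_comb (P := P) hg hb (good_F (P := P) hg hb (k+1)) (good_F (P := P) hg hb k)
    (-1) M l
  have n1 := iter_nonneg (P := P) (g := g)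
    (f := fun x => 1 * F P g (k+1) x + (-m) * F P g k x) (fun x => by linarith [h1 x]) l
  have n2 := iter_nonneg (P := P) (g := g)
    (f := fun x => (-1) * F P g (k+1) x + M * F P g k x) (fun x => by linarith [h2 x]) l
  rw [c1, ← F_add, ← F_add] at n1
  rw [c2, ← F_add, ← F_add] at n2
  constructor
  · intro x
    have := n1 x
    simp only [← add_assoc] at this
    linarith
  · intro x
    have := n2 x
    simp only [← add_assoc] at this
    linarith

lemma intervals {n : ℕ} {K : ℝ} (hK : 1 ≤ K) (hg : Measurable g) (hb : ∀ x, |g x| ≤ Cg)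
    (har : ∀ f : E → ℝ, Good f → (∀ x, 0 ≤ f x) → ∀ x x',
      (T P g)^[n] f x ≤ K * (T P g)^[n] f x') (x0 : E) (j : ℕ) :
    ∃ m M, Real.exp (-Cg) ≤ m ∧
      M - m ≤ (1 - (K⁻¹) ^ 2) ^ j * (Real.exp Cg - Real.exp (-Cg)) ∧
      (∀ x, m * F P g (n * j) x ≤ F P g (n * j + 1) x) ∧
      (∀ x, F P g (n * j + 1) x ≤ M * F P g (n * j) x) := by
  have hK1 : (K⁻¹) ^ 2 ≤ 1 := pow_le_one₀ (by positivity) (inv_le_one_of_one_le₀ hK)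
  induction j with
  | zero =>
    refine ⟨Real.exp (-Cg), Real.exp Cg, le_rfl, by simp, fun x => ?_, fun x => ?_⟩
    · rw [mul_zero, F_succ]
      simpa [F] using (abs_le.1 (hb x)).1
    · rw [mul_zero, F_succ]
      simpa [F] using (abs_le.1 (hb x)).2
  | succ j ih =>
    obtain ⟨m, M, hm, hMm, h1, h2⟩ := ih
    have hp := F_pos (P := P) hg hb (n + n * j)
    rw [F_add] at hp
    obtain ⟨m', M', a1, a2, a3, a4⟩ := contract hK hg hb har (good_F (P := P) hg hb (n * j + 1))
      (good_F (P := P) hg hb (n * j)) (fun x => (F_pos hg hb _ x).le) hp x0 h1 h2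
    have e : n * (j + 1) = n + n * j := by ring
    rw [← F_add, ← F_add] at a3 a4
    refine ⟨m', M', hm.trans a1, ?_, ?_, ?_⟩
    · rw [a2, pow_succ' (1 - (K⁻¹) ^ 2) j, mul_assoc]
      exact mul_le_mul_of_nonneg_left hMm (by linarith)
    · rw [e]; exact a3
    · rw [e]; exact a4

/-- Log-increments. -/
noncomputable def d (P : Kernel E E) (g : E → ℝ) (k : ℕ) (x : E) : ℝ :=
  Real.log (F P g (k + 1) x) - Real.log (F P g k x)

lemma log_intervals {n : ℕ} {K : ℝ} (hK : 1 ≤ K) (hg : Measurable g) (hb : ∀ x, |g x| ≤ Cg)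
    (har : ∀ f : E → ℝ, Good f → (∀ x, 0 ≤ f x) → ∀ x x',
      (T P g)^[n] f x ≤ K * (T P g)^[n] f x') (x0 : E) (j : ℕ) :
    ∃ a b, b - a ≤ (Real.exp Cg * (Real.exp Cg - Real.exp (-Cg))) * (1 - (K⁻¹) ^ 2) ^ j ∧
      ∀ k, n * j ≤ k → ∀ x, a ≤ d P g k x ∧ d P g k x ≤ b := by
  obtain ⟨m, M, hm, hMm, h1, h2⟩ := intervals hK hg hb har x0 j
  have hm0 : 0 < m := (Real.exp_pos _).trans_le hm
  have hmM : m ≤ M := by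
    have := (h1 x0).trans (h2 x0)
    exact le_of_mul_le_mul_right this (F_pos hg hb _ x0)
  have hM0 : 0 < M := hm0.trans_le hmM
  refine ⟨Real.log m, Real.log M, ?_, ?_⟩
  · rw [← Real.log_div hM0.ne' hm0.ne']
    have l1 := Real.log_le_sub_one_of_pos (div_pos hM0 hm0)
    have l2 : M / m - 1 = m⁻¹ * (M - m) := by field_simp
    have l3 : m⁻¹ ≤ Real.exp Cg := by
      have := inv_anti₀ (Real.exp_pos _) hm
      rwa [Real.exp_neg, inv_inv] at this
    have l4 : m⁻¹ * (M - m) ≤ Real.exp Cg * (M - m) :=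
      mul_le_mul_of_nonneg_right l3 (by linarith)
    have l5 := mul_le_mul_of_nonneg_left hMm (Real.exp_pos Cg).le
    linarith
  · intro k hk x
    obtain ⟨l, rfl⟩ := Nat.exists_eq_add_of_le' hk
    obtain ⟨p1, p2⟩ := persist hg hb h1 h2 l
    have q := F_pos (P := P) hg hb (l + n * j) x
    have q' := F_pos (P := P) hg hb (l + n * j + 1) x
    unfold d
    constructor
    · rw [le_sub_iff_add_le, ← Real.log_mul hm0.ne' q.ne']
      exact Real.log_le_log (by positivity) (p1 x)
    · rw [sub_le_iff_le_add, ← Real.log_mul hM0.ne' q.ne']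
      exact Real.log_le_log q' (p2 x)

lemma exists_lam {n : ℕ} {K : ℝ} (hK : 1 ≤ K) (hg : Measurable g) (hb : ∀ x, |g x| ≤ Cg)
    (har : ∀ f : E → ℝ, Good f → (∀ x, 0 ≤ f x) → ∀ x x',
      (T P g)^[n] f x ≤ K * (T P g)^[n] f x') (x0 : E) :
    ∃ lam D r : ℝ, 0 ≤ D ∧ 0 ≤ r ∧ r < 1 ∧
      ∀ j k, n * j ≤ k → ∀ x, |d P g k x - lam| ≤ D * r ^ j := by
  have hK1 : (K⁻¹) ^ 2 ≤ 1 := pow_le_one₀ (by positivity) (inv_le_one_of_one_le₀ hK)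
  have hK2 : 0 < (K⁻¹) ^ 2 := by positivity
  have hint := log_intervals hK hg hb har x0
  choose a b hab hd using hint
  set D := Real.exp Cg * (Real.exp Cg - Real.exp (-Cg))
  set r := 1 - (K⁻¹) ^ 2
  have hcs : CauchySeq (fun j => d P g (n * j) x0) := by
    refine cauchySeq_of_le_geometric r D (by linarith) fun j => ?_
    have u1 := hd j (n * j) le_rfl x0
    have u2 := hd j (n * (j + 1)) (Nat.mul_le_mul_left _ (Nat.le_succ j)) x0
    rw [Real.dist_eq, abs_le]
    have := hab j
    constructor <;> linarith
  obtain ⟨lam, hlam⟩ := cauchySeq_tendsto_of_complete hcs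
  have hbd : ∀ j, a j ≤ lam ∧ lam ≤ b j := by
    intro j
    constructor
    · refine ge_of_tendsto hlam ?_
      filter_upwards [eventually_ge_atTop j] with i hi
      exact (hd j _ (Nat.mul_le_mul_left _ hi) x0).1
    · refine le_of_tendsto hlam ?_
      filter_upwards [eventually_ge_atTop j] with i hi
      exact (hd j _ (Nat.mul_le_mul_left _ hi) x0).2
  refine ⟨lam, D, r, ?_, by linarith, by linarith, fun j k hk x => ?_⟩
  · have := hab 0
    have := hbd 0
    rw [pow_zero, mul_one] at *
    linarith
  · have u := hd j k hk x
    have v := hbd j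
    have := hab j
    rw [abs_le]
    constructor <;> linarith

lemma main (hg : Measurable g) (hb : ∀ x, |g x| ≤ Cg) {n : ℕ} {lam D r : ℝ} (hr0 : 0 ≤ r)
    (hD : 0 ≤ D) (hr : r < 1) (hd : ∀ j k, n * j ≤ k → ∀ x, |d P g k x - lam| ≤ D * r ^ j) :
    ∃ (w : E → ℝ) (lam : ℝ), Measurable w ∧ (∃ C : ℝ, ∀ x, |w x| ≤ C) ∧
      ∀ x : E, w x = g x - lam + Real.log (∫ y, Real.exp (w y) ∂(P x)) := by
  set v : ℕ → E → ℝ := fun j x => Real.log (F P g (n * j) x) - ((n * j : ℕ) : ℝ) * lam with hv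
  have htel : ∀ j x (i : ℕ),
      |(Real.log (F P g (n * j + i) x) - ((n * j + i : ℕ) : ℝ) * lam) - v j x|
        ≤ i * (D * r ^ j) := by
    intro j x i
    induction i with
    | zero => simp [hv]
    | succ i ih =>
      have h1 := hd j (n * j + i) (Nat.le_add_right _ _) x
      unfold d at h1
      rw [abs_le] at *
      simp only [← add_assoc]
      push_cast at *
      constructor <;> linarith
  have hstep : ∀ x j, dist (v j x) (v (j + 1) x) ≤ (n * D) * r ^ j := by
    intro x j
    have := htel j x n
    rw [dist_comm, Real.dist_eq, mul_assoc]
    exact this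
  have hlim : ∀ x, ∃ l, Tendsto (fun j => v j x) atTop (𝓝 l) := fun x =>
    cauchySeq_tendsto_of_complete (cauchySeq_of_le_geometric r (n * D) hr (hstep x))
  choose w hw using hlim
  set R := n * D / (1 - r) with hR
  have h1r : 0 < 1 - r := by linarith
  have hvw : ∀ j x, |v j x - w x| ≤ R := by
    intro j x
    have := dist_le_of_le_geometric_of_tendsto r (n * D) hr (hstep x) (hw x) j
    rw [Real.dist_eq] at this
    refine this.trans ?_
    rw [hR]
    have : r ^ j ≤ 1 := pow_le_one₀ hr0 hr.le
    have hnD : 0 ≤ n * D := by positivity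
    exact div_le_div_of_nonneg_right (mul_le_of_le_one_right hnD this) h1r.le
  have hv0 : ∀ x, v 0 x = 0 := fun x => by simp [hv, F]
  have hwR : ∀ x, |w x| ≤ R := fun x => by
    have := hvw 0 x
    rwa [hv0, zero_sub, abs_neg] at this
  have hvR : ∀ j x, v j x ≤ 2 * R := fun j x => by
    have h1 := abs_le.1 (hvw j x)
    have h2 := abs_le.1 (hwR x)
    linarith
  have hvm : ∀ j, Measurable (v j) := fun j =>
    (Real.measurable_log.comp (good_F hg hb _).1).sub measurable_const
  have hwm : Measurable w := measurable_of_tendsto_metrizable hvm (tendsto_pi_nhds.2 hw)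
  refine ⟨w, lam, hwm, ⟨R, hwR⟩, fun x => ?_⟩
  have hdct : Tendsto (fun j => ∫ y, Real.exp (v j y) ∂(P x)) atTop
      (𝓝 (∫ y, Real.exp (w y) ∂(P x))) := by
    refine tendsto_integral_of_dominated_convergence (fun _ => Real.exp (2 * R))
      (fun j => (Real.measurable_exp.comp (hvm j)).aestronglyMeasurable) (integrable_const _)
      (fun j => Eventually.of_forall fun y => ?_) (Eventually.of_forall fun y => ?_)
    · rw [Real.norm_eq_abs, abs_of_pos (Real.exp_pos _)]
      exact Real.exp_le_exp.2 (hvR j y)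
    · exact (Real.continuous_exp.tendsto _).comp (hw y)
  have hexp : ∀ j, Real.exp (g x) * ∫ y, Real.exp (v j y) ∂(P x)
      = Real.exp (v j x + d P g (n * j) x) := by
    intro j
    have e1 : ∀ y, Real.exp (v j y) = Real.exp (-(((n * j : ℕ) : ℝ) * lam)) * F P g (n * j) y := by
      intro y
      rw [hv]
      simp only
      rw [sub_eq_neg_add, Real.exp_add, Real.exp_log (F_pos hg hb _ y)]
    have e2 : v j x + d P g (n * j) x
        = -(((n * j : ℕ) : ℝ) * lam) + Real.log (F P g (n * j + 1) x) := by
      simp only [hv, d]; ring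
    rw [e2, Real.exp_add, Real.exp_log (F_pos hg hb _ x), F_succ]
    simp_rw [e1]
    rw [integral_const_mul]
    ring
  have hdl : Tendsto (fun j => d P g (n * j) x) atTop (𝓝 lam) := by
    rw [tendsto_iff_dist_tendsto_zero]
    refine squeeze_zero (fun _ => dist_nonneg) (fun j => hd j (n * j) le_rfl x) ?_
    simpa using (tendsto_pow_atTop_nhds_zero_of_lt_one hr0 hr).const_mul D
  have hL := hdct.const_mul (Real.exp (g x))
  have hR' := (Real.continuous_exp.tendsto _).comp ((hw x).add hdl)
  have heq : Real.exp (g x) * ∫ y, Real.exp (w y) ∂(P x) = Real.exp (w x + lam) := by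
    refine tendsto_nhds_unique hL (hR'.congr fun j => ?_)
    exact (hexp j).symm
  have hI : ∫ y, Real.exp (w y) ∂(P x) = Real.exp (w x + lam - g x) := by
    rw [Real.exp_sub, ← heq]
    field_simp
  rw [hI, Real.log_exp]
  ring

end MPEAux

/-- Under the multi-step strong mixing condition (A.3) — `P_n(x,B) ≤ L · P_n(x',B)` for some
`n ≥ 1`, `L ≥ 1`, and all `x, x', B` — a bounded MPE solution exists for every bounded
measurable reward `g`. -/
theorem mpe_exists_of_strong_mixing {E : Type*} [MeasurableSpace E]
    (P : Kernel E E) [IsMarkovKernel P]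
    (n : ℕ) (hn : 1 ≤ n) (L : ℝ) (hL : 1 ≤ L)
    (hsm : ∀ x x' : E, ∀ B : Set E, MeasurableSet B →
      ((stepKernel P n) x B).toReal ≤ L * ((stepKernel P n) x' B).toReal)
    (g : E → ℝ) (hg_meas : Measurable g) (Cg : ℝ) (hg_bdd : ∀ x, |g x| ≤ Cg) :
    ∃ (w : E → ℝ) (lam : ℝ), Measurable w ∧ (∃ C : ℝ, ∀ x, |w x| ≤ C) ∧
      ∀ x : E, w x = g x - lam + Real.log (∫ y, Real.exp (w y) ∂(P x)) := by
  rcases isEmpty_or_nonempty E with hE | ⟨⟨x0⟩⟩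
  · exact ⟨fun _ => 0, 0, measurable_const, ⟨0, fun x => (hE.false x).elim⟩,
      fun x => (hE.false x).elim⟩
  · have hC : 0 ≤ Cg := (abs_nonneg _).trans (hg_bdd x0)
    have hK : 1 ≤ L * Real.exp (2 * (n * Cg)) :=
      one_le_mul_of_one_le_of_one_le hL (Real.one_le_exp (by positivity))
    obtain ⟨lam, D, r, hD, hr0, hr, hd⟩ := MPEAux.exists_lam hK hg_meas hg_bdd
      (fun f hf h0 x x' => MPEAux.iter_harnack hL hsm hg_meas hg_bdd hf h0 x x') x0
    exact MPEAux.main hg_meas hg_bdd hr0 hD hr hd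
end
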